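/- Let 0 < t < ∞ and 1 < p, q < ∞. There exists a constant C, independent of t, such that for every locally integrable function f on ℝ^n with Mf ∈ (E_p^q)_t(ℝ^n), one has ‖M f‖_{(E_p^q)_t} ≤ C ‖M^♯ f‖_{(E_p^q)_t}. -/

import Mathlib

open MeasureTheory ENNReal Metric

noncomputable section

/-- The (closed) cube centered at `x` with side length `r`. -/
def cube {n : ℕ} (x : EuclideanSpace ℝ (Fin n)) (r : ℝ) : Set (EuclideanSpace ℝ (Fin n)) :=
  {y | ∀ i, |y i - x i| ≤ r / 2}

/-- The average `f_Q = |Q|⁻¹ ∫_Q f` of `f` over a set `Q`. -/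
def setAvg {n : ℕ} (Q : Set (EuclideanSpace ℝ (Fin n))) (f : EuclideanSpace ℝ (Fin n) → ℝ) : ℝ :=
  (volume Q).toReal⁻¹ * ∫ y in Q, f y

/-- Slice norm of an `ℝ≥0∞`-valued function. -/
def sliceNormE {n : ℕ} (p q t : ℝ) (g : EuclideanSpace ℝ (Fin n) → ℝ≥0∞) : ℝ≥0∞ :=
  (∫⁻ x, ((volume (cube x t))⁻¹ * ∫⁻ y in cube x t, g y ^ p) ^ (q / p)) ^ (1 / q)

/-- The slice space norm `‖f‖_{(E_p^q)_t}`. -/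
def sliceNorm {n : ℕ} (p q t : ℝ) (f : EuclideanSpace ℝ (Fin n) → ℝ) : ℝ≥0∞ :=
  sliceNormE p q t fun y => ENNReal.ofReal |f y|

/-- Membership in the slice space `(E_p^q)_t(ℝⁿ)`. -/
def MemSlice {n : ℕ} (p q t : ℝ) (f : EuclideanSpace ℝ (Fin n) → ℝ) : Prop :=
  Measurable f ∧ sliceNorm p q t f ≠ ∞

/-- The BMO seminorm, as a supremum over all cubes. -/
def bmoNorm {n : ℕ} (b : EuclideanSpace ℝ (Fin n) → ℝ) : ℝ≥0∞ :=
  ⨆ (x : EuclideanSpace ℝ (Fin n)) (r : ℝ) (_ : 0 < r),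
    (volume (cube x r))⁻¹ * ∫⁻ y in cube x r, ENNReal.ofReal |b y - setAvg (cube x r) b|

/-- Membership in `BMO(ℝⁿ)`. -/
def MemBMO {n : ℕ} (b : EuclideanSpace ℝ (Fin n) → ℝ) : Prop :=
  LocallyIntegrable b volume ∧ bmoNorm b ≠ ∞

/-- `Ω` is homogeneous of degree zero. -/
def HomogZero {n : ℕ} (Ω : EuclideanSpace ℝ (Fin n) → ℝ) : Prop :=
  ∀ lam : ℝ, 0 < lam → ∀ x : EuclideanSpace ℝ (Fin n), x ≠ 0 → Ω (lam • x) = Ω x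

/-- `Ω` has mean value zero on the unit sphere. -/
def MeanZeroOnSphere {n : ℕ} (Ω : EuclideanSpace ℝ (Fin n) → ℝ) : Prop :=
  ∫ x : sphere (0 : EuclideanSpace ℝ (Fin n)) 1, Ω x
    ∂((volume : Measure (EuclideanSpace ℝ (Fin n))).toSphere) = 0

/-- The fractional integral operator with rough kernel,
`T_{Ω,α} f (x) = ∫ Ω(x-y) |x-y|^{α-n} f(y) dy`. -/
def fracInt {n : ℕ} (Ω : EuclideanSpace ℝ (Fin n) → ℝ) (α : ℝ)
    (f : EuclideanSpace ℝ (Fin n) → ℝ) (x : EuclideanSpace ℝ (Fin n)) : ℝ :=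
  ∫ y, Ω (x - y) * ‖x - y‖ ^ (α - n) * f y

/-- The commutator `[b, T_{Ω,α}] f = b ⬝ T_{Ω,α} f - T_{Ω,α}(b f)`. -/
def commutatorOp {n : ℕ} (Ω : EuclideanSpace ℝ (Fin n) → ℝ) (α : ℝ)
    (b f : EuclideanSpace ℝ (Fin n) → ℝ) : EuclideanSpace ℝ (Fin n) → ℝ :=
  fun x => b x * fracInt Ω α f x - fracInt Ω α (fun y => b y * f y) x

/-- The fractional maximal operator `M_γ` (over cubes); `γ = 0` gives the
Hardy–Littlewood maximal operator. -/
def fracMax {n : ℕ} (γ : ℝ) (f : EuclideanSpace ℝ (Fin n) → ℝ)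
    (x : EuclideanSpace ℝ (Fin n)) : ℝ≥0∞ :=
  ⨆ (z : EuclideanSpace ℝ (Fin n)) (r : ℝ) (_ : 0 < r) (_ : x ∈ cube z r),
    volume (cube z r) ^ (γ / n - 1) * ∫⁻ y in cube z r, ENNReal.ofReal |f y|

/-- The Fefferman–Stein sharp maximal operator `M^♯`. -/
def sharpMax {n : ℕ} (f : EuclideanSpace ℝ (Fin n) → ℝ)
    (x : EuclideanSpace ℝ (Fin n)) : ℝ≥0∞ :=
  ⨆ (z : EuclideanSpace ℝ (Fin n)) (r : ℝ) (_ : 0 < r) (_ : x ∈ cube z r),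
    (volume (cube z r))⁻¹ * ∫⁻ y in cube z r, ENNReal.ofReal |f y - setAvg (cube z r) f|

/-- The `L^p` norm. -/
def lpNorm {n : ℕ} (p : ℝ) (f : EuclideanSpace ℝ (Fin n) → ℝ) : ℝ≥0∞ :=
  (∫⁻ x, ENNReal.ofReal |f x| ^ p) ^ (1 / p)

/-- The set of admissible Hölder–Lipschitz constants of order `β` for `b`. -/
def LipConstSet {n : ℕ} (β : ℝ) (b : EuclideanSpace ℝ (Fin n) → ℝ) : Set ℝ :=
  {C : ℝ | ∀ x y, |b x - b y| ≤ C * dist x y ^ β}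

/-- Membership in the Lipschitz space `Lip_β(ℝⁿ)`. -/
def MemLip {n : ℕ} (β : ℝ) (b : EuclideanSpace ℝ (Fin n) → ℝ) : Prop :=
  (LipConstSet β b).Nonempty

/-- The `Lip_β` norm: the least admissible constant. -/
def lipNorm {n : ℕ} (β : ℝ) (b : EuclideanSpace ℝ (Fin n) → ℝ) : ℝ :=
  sInf (LipConstSet β b)

/-- A good-`λ` inequality, relative to a finite measure and valid for levels above `a`, implies
the corresponding `L^p` bound. -/
theorem lintegral_rpow_le_of_goodLambda {α : Type*} [MeasurableSpace α] (μ : Measure α)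
    [IsFiniteMeasure μ] {F G : α → ℝ≥0∞} (hF : Measurable F) (hG : Measurable G) {p : ℝ}
    (hp : 0 < p) {a γ : ℝ} (ha : 0 ≤ a) (hγ : 0 < γ)
    (h : ∀ l : ℝ, a ≤ l → 0 < l →
      μ {x | ENNReal.ofReal (2 * l) < F x ∧ G x ≤ ENNReal.ofReal (γ * l)} ≤
        ENNReal.ofReal ((2 ^ p)⁻¹ / 2) * μ {x | ENNReal.ofReal l < F x}) :
    ∫⁻ x, F x ^ p ∂μ ≤ ENNReal.ofReal (2 * 2 ^ p) *
      (ENNReal.ofReal (a ^ p) * μ Set.univ + ENNReal.ofReal ((γ ^ p)⁻¹) * ∫⁻ x, G x ^ p ∂μ) := by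
  have h2p : (0 : ℝ) < 2 ^ p := by positivity
  set ε : ℝ := (2 ^ p)⁻¹ / 2 with hε
  have hε0 : 0 < ε := by positivity
  have key : ∀ N : ℕ, ∫⁻ x, (min (F x) N) ^ p ∂μ ≤ ENNReal.ofReal (2 * 2 ^ p) *
      (ENNReal.ofReal (a ^ p) * μ Set.univ + ENNReal.ofReal ((γ ^ p)⁻¹) * ∫⁻ x, G x ^ p ∂μ) := by
    intro N
    set φ : α → ℝ := fun x => (min (F x) N).toReal with hφ
    set ψ : α → ℝ := fun x => (min (G x) (ENNReal.ofReal (γ * N))).toReal with hψ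
    have φnn : ∀ x, 0 ≤ φ x := fun x => ENNReal.toReal_nonneg
    have ψnn : ∀ x, 0 ≤ ψ x := fun x => ENNReal.toReal_nonneg
    have φm : Measurable φ := (hF.min measurable_const).ennreal_toReal
    have ψm : Measurable ψ := (hG.min measurable_const).ennreal_toReal
    have φfin : ∀ x, min (F x) (N : ℝ≥0∞) ≠ ∞ := fun x =>
      ne_top_of_le_ne_top (ENNReal.natCast_ne_top N) (min_le_right _ _)
    have ψfin : ∀ x, min (G x) (ENNReal.ofReal (γ * N)) ≠ ∞ := fun x =>
      ne_top_of_le_ne_top ENNReal.ofReal_ne_top (min_le_right _ _)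
    have φlt : ∀ x (l : ℝ), 0 ≤ l →
        (l < φ x ↔ ENNReal.ofReal l < F x ∧ l < N) := by
      intro x l hl
      rw [hφ]
      simp only
      rw [← ENNReal.ofReal_lt_iff_lt_toReal hl (φfin x), lt_min_iff,
        ← ENNReal.ofReal_natCast, ENNReal.ofReal_lt_ofReal_iff_of_nonneg hl]
    have ψlt : ∀ x (l : ℝ), 0 ≤ l →
        (l < ψ x ↔ ENNReal.ofReal l < G x ∧ l < γ * N) := by
      intro x l hl
      rw [hψ]
      simp only
      rw [← ENNReal.ofReal_lt_iff_lt_toReal hl (ψfin x), lt_min_iff,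
        ENNReal.ofReal_lt_ofReal_iff_of_nonneg hl]
    have main : ∀ l : ℝ, 0 < l → μ {x | l < φ x / 2} ≤
        μ {x | l < (fun _ : α => a) x} + μ {x | l < ψ x / γ}
          + ENNReal.ofReal ε * μ {x | l < φ x} := by
      intro l hl
      rcases lt_or_ge l a with hla | hla
      · have : {x : α | l < (fun _ : α => a) x} = Set.univ := by
          ext x; simpa using hla
        rw [this, add_assoc]
        exact (measure_mono (Set.subset_univ _)).trans le_self_add
      rcases le_or_gt (N : ℝ) l with hNl | hNl
      · have : {x | l < φ x / 2} = ∅ := by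
          ext x
          simp only [Set.mem_ofPred_eq, Set.mem_empty_iff_false, iff_false]
          intro hx
          have := ((φlt x (2 * l) (by positivity)).1 (by linarith)).2
          linarith
        rw [this]; simp
      · have e : {x | l < φ x} = {x | ENNReal.ofReal l < F x} := by
          ext x
          simp only [Set.mem_ofPred_eq]
          rw [φlt x l hl.le]; simp [hNl]
        rw [e]
        have : {x | l < φ x / 2} ⊆ {x | l < ψ x / γ} ∪
            {x | ENNReal.ofReal (2 * l) < F x ∧ G x ≤ ENNReal.ofReal (γ * l)} := by
          intro x hx
          simp only [Set.mem_ofPred_eq, Set.mem_union] at hx ⊢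
          have hx' := (φlt x (2 * l) (by positivity)).1 (by linarith)
          by_cases hg : G x ≤ ENNReal.ofReal (γ * l)
          · exact Or.inr ⟨hx'.1, hg⟩
          · left
            rw [lt_div_iff₀ hγ, mul_comm]
            exact (ψlt x _ (by positivity)).2 ⟨not_le.1 hg, by gcongr⟩
        calc μ {x | l < φ x / 2} ≤ _ := (measure_mono this).trans (measure_union_le _ _)
          _ ≤ μ {x | l < ψ x / γ} + ENNReal.ofReal ε * μ {x | ENNReal.ofReal l < F x} := by
            gcongr; exact h l hla hl
          _ ≤ _ := by
            gcongr; exact le_add_self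
    have tail : ∀ {u : α → ℝ}, Measurable u →
        Measurable fun l : ℝ => μ {x | l < u x} * ENNReal.ofReal (l ^ (p - 1)) := by
      intro u hu
      refine Measurable.mul ?_ (by fun_prop)
      have : Antitone fun l : ℝ => μ {x | l < u x} := fun s t hst =>
        measure_mono fun x (hx : t < u x) => lt_of_le_of_lt hst hx
      exact this.measurable
    have big : ∫⁻ x, ENNReal.ofReal ((φ x / 2) ^ p) ∂μ ≤
        ∫⁻ _, ENNReal.ofReal (a ^ p) ∂μ + ∫⁻ x, ENNReal.ofReal ((ψ x / γ) ^ p) ∂μ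
          + ENNReal.ofReal ε * ∫⁻ x, ENNReal.ofReal (φ x ^ p) ∂μ := by
      have e1 := lintegral_rpow_eq_lintegral_meas_lt_mul μ (f := fun x => φ x / 2)
        (Filter.Eventually.of_forall fun x => by have := φnn x; simp only [Pi.zero_apply]; positivity)
        (by fun_prop) hp
      have e2 := lintegral_rpow_eq_lintegral_meas_lt_mul μ (f := fun x => ψ x / γ)
        (Filter.Eventually.of_forall fun x => by have := ψnn x; simp only [Pi.zero_apply]; positivity)
        (by fun_prop) hp
      have e3 := lintegral_rpow_eq_lintegral_meas_lt_mul μ (f := fun _ => a)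
        (Filter.Eventually.of_forall fun x => ha) (by fun_prop) hp
      have e4 := lintegral_rpow_eq_lintegral_meas_lt_mul μ (f := φ)
        (Filter.Eventually.of_forall φnn) φm.aemeasurable hp
      rw [e1, e2, e3, e4, mul_left_comm, ← mul_add, ← mul_add]
      gcongr
      have m2 := tail (ψm.div_const γ)
      have m3 := tail (u := fun _ : α => a) measurable_const
      rw [← lintegral_add_left m3, ← lintegral_const_mul _ (tail φm),
        ← lintegral_add_right _ ((tail φm).const_mul _)]
      refine setLIntegral_mono' measurableSet_Ioi fun l hl => ?_
      calc _ ≤ _ := mul_le_mul_left (main l hl) _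
        _ = _ := by rw [add_mul, add_mul, mul_assoc]
    have Iφ : ∫⁻ x, ENNReal.ofReal (φ x ^ p) ∂μ = ∫⁻ x, (min (F x) N) ^ p ∂μ := by
      refine lintegral_congr fun x => ?_
      rw [← ENNReal.ofReal_rpow_of_nonneg (φnn x) hp.le, hφ]
      simp only
      rw [ENNReal.ofReal_toReal (φfin x)]
    have Iφ2 : ∫⁻ x, ENNReal.ofReal ((φ x / 2) ^ p) ∂μ =
        ENNReal.ofReal (2 * ε) * ∫⁻ x, (min (F x) N) ^ p ∂μ := by
      rw [← Iφ, ← lintegral_const_mul _ (by fun_prop)]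
      refine lintegral_congr fun x => ?_
      rw [← ENNReal.ofReal_mul (by positivity), Real.div_rpow (φnn x) (by norm_num), hε]
      congr 1
      field_simp
    have Iψ : ∫⁻ x, ENNReal.ofReal ((ψ x / γ) ^ p) ∂μ ≤
        ENNReal.ofReal ((γ ^ p)⁻¹) * ∫⁻ x, G x ^ p ∂μ := by
      rw [← lintegral_const_mul _ (hG.pow_const p)]
      refine lintegral_mono fun x => ?_
      rw [Real.div_rpow (ψnn x) hγ.le, div_eq_inv_mul, ENNReal.ofReal_mul (by positivity),
        ← ENNReal.ofReal_rpow_of_nonneg (ψnn x) hp.le, hψ]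
      simp only
      rw [ENNReal.ofReal_toReal (ψfin x)]
      gcongr
      exact min_le_left _ _
    have fin : ∫⁻ x, (min (F x) N) ^ p ∂μ ≠ ∞ := by
      refine ne_top_of_le_ne_top ?_ (lintegral_mono (g := fun _ => (N : ℝ≥0∞) ^ p) fun x => ?_)
      · rw [lintegral_const]
        exact ENNReal.mul_ne_top (ENNReal.rpow_ne_top_of_nonneg hp.le (ENNReal.natCast_ne_top N))
          (measure_ne_top _ _)
      · exact ENNReal.rpow_le_rpow (min_le_right _ _) hp.le
    rw [Iφ2, Iφ, lintegral_const] at big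
    set I := ∫⁻ x, (min (F x) N) ^ p ∂μ
    set X := ENNReal.ofReal (a ^ p) * μ Set.univ + ENNReal.ofReal ((γ ^ p)⁻¹) * ∫⁻ x, G x ^ p ∂μ
    have b2 : ENNReal.ofReal ε * I + ENNReal.ofReal ε * I ≤ X + ENNReal.ofReal ε * I := by
      calc _ = ENNReal.ofReal (2 * ε) * I := by
            rw [← add_mul, ← ENNReal.ofReal_add hε0.le hε0.le, two_mul]
        _ ≤ _ := big.trans (add_le_add (add_le_add le_rfl Iψ) le_rfl)
    have b3 := (ENNReal.add_le_add_iff_right (ENNReal.mul_ne_top ENNReal.ofReal_ne_top fin)).1 b2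
    calc I = ENNReal.ofReal (2 * 2 ^ p) * (ENNReal.ofReal ε * I) := by
          rw [← mul_assoc, ← ENNReal.ofReal_mul (by positivity)]
          have : 2 * 2 ^ p * ε = 1 := by rw [hε]; field_simp
          rw [this]; simp
      _ ≤ _ := by gcongr
  have conv : ∫⁻ x, F x ^ p ∂μ = ⨆ N : ℕ, ∫⁻ x, (min (F x) N) ^ p ∂μ := by
    rw [← lintegral_iSup (fun N => (hF.min measurable_const).pow_const p)]
    · refine lintegral_congr fun x => ?_
      refine le_antisymm ?_ (iSup_le fun N => by gcongr; exact min_le_left _ _)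
      rcases eq_or_ne (F x) ∞ with hx | hx
      · rw [hx, ENNReal.top_rpow_of_pos hp]
        simp only [le_top, inf_of_le_right]
        have := (ENNReal.orderIsoRpow p hp).map_iSup (fun N : ℕ => (N : ℝ≥0∞))
        simp only [ENNReal.orderIsoRpow_apply, ENNReal.iSup_natCast] at this
        rw [← this, ENNReal.top_rpow_of_pos hp]
      · obtain ⟨N, hN⟩ := ENNReal.exists_nat_gt hx
        refine le_iSup_of_le N ?_
        rw [min_eq_left hN.le]
    · intro i j hij x
      simp only
      gcongr
  rw [conv]
  exact iSup_le key

/-- The average `|B|⁻¹ ∫_B g` of a nonnegative function. -/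
def meanOn {n : ℕ} (g : (Fin n → ℝ) → ℝ≥0∞) (B : Set (Fin n → ℝ)) : ℝ≥0∞ :=
  (volume B)⁻¹ * ∫⁻ y in B, g y

/-- The mean oscillation `|B|⁻¹ ∫_B |f - f_B|`. -/
def meanOsc {n : ℕ} (f : (Fin n → ℝ) → ℝ) (B : Set (Fin n → ℝ)) : ℝ≥0∞ :=
  meanOn (fun y => ‖f y - (volume B).toReal⁻¹ * ∫ z in B, f z‖ₑ) B

/-- The supremum of `F` over the open balls of a family `T` (given by centres and radii)
that contain `x`. -/
def ballSup {n : ℕ} (T : Set ((Fin n → ℝ) × ℝ)) (F : Set (Fin n → ℝ) → ℝ≥0∞)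
    (x : Fin n → ℝ) : ℝ≥0∞ :=
  ⨆ a ∈ T, ⨆ _ : x ∈ ball a.1 a.2, F (ball a.1 a.2)

theorem lt_ballSup_iff {n : ℕ} {T : Set ((Fin n → ℝ) × ℝ)} {F : Set (Fin n → ℝ) → ℝ≥0∞}
    {x : Fin n → ℝ} {l : ℝ≥0∞} :
    l < ballSup T F x ↔ ∃ a ∈ T, x ∈ ball a.1 a.2 ∧ l < F (ball a.1 a.2) := by
  simp only [ballSup, lt_iSup_iff, exists_prop]

theorem le_ballSup {n : ℕ} {T : Set ((Fin n → ℝ) × ℝ)} {F : Set (Fin n → ℝ) → ℝ≥0∞}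
    {x z : Fin n → ℝ} {r : ℝ} (h : (z, r) ∈ T) (hx : x ∈ ball z r) :
    F (ball z r) ≤ ballSup T F x :=
  le_iSup₂_of_le (z, r) h (le_iSup_of_le hx le_rfl)

theorem measurable_ballSup {n : ℕ} (T : Set ((Fin n → ℝ) × ℝ)) (F : Set (Fin n → ℝ) → ℝ≥0∞) :
    Measurable (ballSup T F) := by
  refine measurable_of_Ioi fun l => IsOpen.measurableSet ?_
  have : ballSup T F ⁻¹' Set.Ioi l =
      ⋃ a ∈ T, ⋃ _ : l < F (ball a.1 a.2), ball a.1 a.2 := by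
    ext x
    simp only [Set.mem_preimage, Set.mem_Ioi, lt_ballSup_iff, Set.mem_iUnion, exists_prop]
    exact exists_congr fun a => by tauto
  rw [this]
  exact isOpen_biUnion fun a _ => isOpen_iUnion fun _ => isOpen_ball

theorem volume_closedBall_le_mul {n : ℕ} {c r r' : ℝ} (hr : 0 < r) (hr' : 0 ≤ r')
    (hc : r' ≤ c * r) (z z' : Fin n → ℝ) :
    volume (closedBall z' r') ≤ ENNReal.ofReal c ^ n * volume (ball z r) := by
  have hc0 : 0 ≤ c := nonneg_of_mul_nonneg_left (hr'.trans hc) hr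
  rw [Real.volume_pi_closedBall _ hr', Real.volume_pi_ball _ hr, Fintype.card_fin,
    ← ENNReal.ofReal_pow hc0, ← ENNReal.ofReal_mul (by positivity), ← mul_pow]
  refine ENNReal.ofReal_le_ofReal (pow_le_pow_left₀ (by positivity) (by linarith) n)

theorem volume_ball_le_mul {n : ℕ} {c r r' : ℝ} (hr : 0 < r) (hr' : 0 ≤ r')
    (hc : r' ≤ c * r) (z z' : Fin n → ℝ) :
    volume (ball z' r') ≤ ENNReal.ofReal c ^ n * volume (ball z r) :=
  (measure_mono ball_subset_closedBall).trans (volume_closedBall_le_mul hr hr' hc z z')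

theorem volume_mul_meanOn {n : ℕ} (g : (Fin n → ℝ) → ℝ≥0∞) {B : Set (Fin n → ℝ)}
    (h0 : volume B ≠ 0) (h1 : volume B ≠ ∞) : volume B * meanOn g B = ∫⁻ y in B, g y := by
  rw [meanOn, ← mul_assoc, ENNReal.mul_inv_cancel h0 h1, one_mul]

theorem meanOn_le_mul {n : ℕ} (g : (Fin n → ℝ) → ℝ≥0∞) {B B' : Set (Fin n → ℝ)} {K : ℝ≥0∞}
    (hB : B ⊆ B') (h0 : volume B ≠ 0) (h1 : volume B' ≠ ∞) (hK : volume B' ≤ K * volume B) :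
    meanOn g B ≤ K * meanOn g B' := by
  have h0' : volume B' ≠ 0 := fun h => h0 (measure_mono_null hB h)
  have h1' : volume B ≠ ∞ := ne_top_of_le_ne_top h1 (measure_mono hB)
  rw [meanOn, ← ENNReal.div_eq_inv_mul, ENNReal.div_le_iff h0 h1']
  calc ∫⁻ y in B, g y ≤ ∫⁻ y in B', g y := lintegral_mono_set hB
    _ = volume B' * meanOn g B' := (volume_mul_meanOn g h0' h1).symm
    _ ≤ K * volume B * meanOn g B' := by gcongr
    _ = _ := by ring

theorem enorm_average_le {n : ℕ} (f : (Fin n → ℝ) → ℝ) (B : Set (Fin n → ℝ)) :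
    ‖(volume B).toReal⁻¹ * ∫ z in B, f z‖ₑ ≤ meanOn (fun y => ‖f y‖ₑ) B := by
  rw [enorm_mul, meanOn]
  gcongr
  · rw [Real.enorm_eq_ofReal (by positivity)]
    rw [← ENNReal.toReal_inv]
    exact ENNReal.ofReal_toReal_le
  · exact enorm_integral_le_lintegral_enorm _

theorem meanOsc_le_mul {n : ℕ} (f : (Fin n → ℝ) → ℝ) {B B' : Set (Fin n → ℝ)} {K : ℝ≥0∞}
    (hB : B ⊆ B') (h0 : volume B ≠ 0) (h1 : volume B' ≠ ∞) (hK : volume B' ≤ K * volume B)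
    (hf : IntegrableOn f B') :
    meanOsc f B ≤ 2 * K * meanOsc f B' := by
  have h1' : volume B ≠ ∞ := ne_top_of_le_ne_top h1 (measure_mono hB)
  set c := (volume B').toReal⁻¹ * ∫ z in B', f z with hc
  set b := (volume B).toReal⁻¹ * ∫ z in B, f z with hb
  have hfB : IntegrableOn f B := hf.mono_set hB
  have hpos : (volume B).toReal ≠ 0 := (ENNReal.toReal_pos h0 h1').ne'
  have hcb : ‖c - b‖ₑ ≤ meanOn (fun y => ‖f y - c‖ₑ) B := by
    have : b - c = (volume B).toReal⁻¹ * ∫ z in B, (f z - c) := by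
      rw [integral_sub hfB (integrableOn_const h1'), setIntegral_const, hb, smul_eq_mul,
        Measure.real]
      field_simp
    rw [← enorm_neg, neg_sub, this]
    exact enorm_average_le _ _
  calc meanOsc f B ≤ meanOn (fun y => ‖f y - c‖ₑ + ‖c - b‖ₑ) B := by
        unfold meanOsc meanOn
        gcongr with y
        simp only
        rw [← sub_add_sub_cancel (f y) c b]
        exact enorm_add_le _ _
    _ = meanOn (fun y => ‖f y - c‖ₑ) B + ‖c - b‖ₑ := by
        unfold meanOn
        rw [lintegral_add_right _ measurable_const, setLIntegral_const, mul_add, mul_left_comm,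
          ENNReal.inv_mul_cancel h0 h1', mul_one]
    _ ≤ 2 * meanOn (fun y => ‖f y - c‖ₑ) B := by rw [two_mul]; gcongr
    _ ≤ 2 * (K * meanOn (fun y => ‖f y - c‖ₑ) B') := by
        gcongr; exact meanOn_le_mul _ hB h0 h1 hK
    _ = _ := by rw [meanOsc, mul_assoc]

theorem volume_ball_ne_zero {n : ℕ} (z : Fin n → ℝ) {r : ℝ} (hr : 0 < r) :
    volume (ball z r) ≠ 0 :=
  (measure_ball_pos _ _ hr).ne'

theorem exists_disjoint_balls {n : ℕ} (T : Set ((Fin n → ℝ) × ℝ)) (R : ℝ)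
    (hT : ∀ a ∈ T, 0 < a.2 ∧ a.2 ≤ R) :
    ∃ u ⊆ T, u.Countable ∧ u.PairwiseDisjoint (fun a => ball a.1 a.2) ∧
      ∀ a ∈ T, ∃ b ∈ u, (ball a.1 a.2 ∩ ball b.1 b.2).Nonempty ∧ a.2 ≤ 2 * b.2 := by
  have ne : ∀ a ∈ T, (ball a.1 a.2).Nonempty := fun a ha => nonempty_ball.2 (hT a ha).1
  obtain ⟨u, uT, ud, hu⟩ := Vitali.exists_disjoint_subfamily_covering_enlargement
    (fun a : (Fin n → ℝ) × ℝ => ball a.1 a.2) T (fun a => a.2) 2 (by norm_num)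
    (fun a ha => (hT a ha).1.le) R (fun a ha => (hT a ha).2) ne
  exact ⟨u, uT, ud.countable_of_isOpen (fun _ _ => isOpen_ball) fun a ha => ne a (uT ha), ud, hu⟩

/-- The weak type `(1,1)` estimate for the maximal function. -/
theorem mul_volume_iUnion_ball_le {n : ℕ} (g : (Fin n → ℝ) → ℝ≥0∞)
    (T : Set ((Fin n → ℝ) × ℝ)) (R : ℝ) (hT : ∀ a ∈ T, 0 < a.2 ∧ a.2 ≤ R)
    {U : Set (Fin n → ℝ)} (hU : ∀ a ∈ T, ball a.1 a.2 ⊆ U) {l : ℝ≥0∞}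
    (hl : ∀ a ∈ T, l ≤ meanOn g (ball a.1 a.2)) :
    l * volume (⋃ a ∈ T, ball a.1 a.2) ≤ 5 ^ n * ∫⁻ y in U, g y := by
  obtain ⟨u, uT, uc, ud, hu⟩ := exists_disjoint_balls T R hT
  have cover : ⋃ a ∈ T, ball a.1 a.2 ⊆ ⋃ b ∈ u, ball b.1 (5 * b.2) := by
    refine Set.iUnion₂_subset fun a ha => ?_
    obtain ⟨b, hb, ⟨w, hwa, hwb⟩, hab⟩ := hu a ha
    refine Set.subset_biUnion_of_mem (u := fun b : (Fin n → ℝ) × ℝ => ball b.1 (5 * b.2)) hb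
      |>.trans' fun x hx => ?_
    rw [mem_ball] at *
    have := dist_triangle4 x a.1 w b.1
    rw [dist_comm a.1 w] at this
    linarith
  calc l * volume (⋃ a ∈ T, ball a.1 a.2)
      ≤ l * ∑' b : u, volume (ball b.1.1 (5 * b.1.2)) := by
        gcongr
        exact (measure_mono cover).trans (measure_biUnion_le _ uc _)
    _ = ∑' b : u, l * volume (ball b.1.1 (5 * b.1.2)) := ENNReal.tsum_mul_left.symm
    _ ≤ ∑' b : u, 5 ^ n * ∫⁻ y in ball b.1.1 b.1.2, g y := by
        refine ENNReal.tsum_le_tsum fun b => ?_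
        have hr := (hT b.1 (uT b.2)).1
        calc l * volume (ball b.1.1 (5 * b.1.2))
            ≤ l * (ENNReal.ofReal 5 ^ n * volume (ball b.1.1 b.1.2)) := by
              gcongr
              exact volume_ball_le_mul hr (by positivity) le_rfl _ _
          _ ≤ meanOn g (ball b.1.1 b.1.2) * (ENNReal.ofReal 5 ^ n * volume (ball b.1.1 b.1.2)) := by
              gcongr
              exact hl _ (uT b.2)
          _ = 5 ^ n * (volume (ball b.1.1 b.1.2) * meanOn g (ball b.1.1 b.1.2)) := by
              rw [ENNReal.ofReal_ofNat]; ring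
          _ = _ := by rw [volume_mul_meanOn _ (volume_ball_ne_zero _ hr) measure_ball_lt_top.ne]
    _ = 5 ^ n * ∫⁻ y in ⋃ b ∈ u, ball b.1 b.2, g y := by
        rw [ENNReal.tsum_mul_left, lintegral_biUnion uc (fun _ _ => measurableSet_ball) ud]
    _ ≤ _ := by
        gcongr
        exact Set.iUnion₂_subset fun b hb => hU b (uT hb)

theorem meanOn_add_const {n : ℕ} (g : (Fin n → ℝ) → ℝ≥0∞) (c : ℝ≥0∞) {B : Set (Fin n → ℝ)}
    (h0 : volume B ≠ 0) (h1 : volume B ≠ ∞) : meanOn (fun y => g y + c) B = meanOn g B + c := by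
  unfold meanOn
  rw [lintegral_add_right _ measurable_const, setLIntegral_const, mul_add, mul_left_comm,
    ENNReal.inv_mul_cancel h0 h1, mul_one]

theorem meanOn_mono {n : ℕ} {g h : (Fin n → ℝ) → ℝ≥0∞} (hgh : ∀ y, g y ≤ h y)
    (B : Set (Fin n → ℝ)) : meanOn g B ≤ meanOn h B :=
  mul_le_mul_right (lintegral_mono hgh) _

/-- A ball of radius at most `R` can be translated into a given ball of radius `R` without losing
any point of the latter. -/
theorem exists_ball_translate_subset {n : ℕ} (z x₀ : Fin n → ℝ) {s R : ℝ} (hs : 0 < s)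
    (hsR : s ≤ R) :
    ∃ z', ball z s ∩ ball x₀ R ⊆ ball z' s ∧ ball z' s ⊆ ball x₀ R := by
  have hR := hs.trans_le hsR
  refine ⟨fun i => max (x₀ i - (R - s)) (min (x₀ i + (R - s)) (z i)), ?_, ?_⟩
  · rintro y ⟨hy, hy'⟩
    rw [mem_ball, dist_pi_lt_iff hs] at *
    rw [dist_pi_lt_iff hR] at hy'
    intro i
    have h1 := hy i
    have h2 := hy' i
    rw [Real.dist_eq, abs_lt] at *
    rcases max_cases (x₀ i - (R - s)) (min (x₀ i + (R - s)) (z i)) with h | h <;>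
    rcases min_cases (x₀ i + (R - s)) (z i) with h' | h' <;> constructor <;> linarith
  · intro y hy
    rw [mem_ball, dist_pi_lt_iff hs] at hy
    rw [mem_ball, dist_pi_lt_iff hR]
    intro i
    have h1 := hy i
    rw [Real.dist_eq, abs_lt] at *
    rcases max_cases (x₀ i - (R - s)) (min (x₀ i + (R - s)) (z i)) with h | h <;>
    rcases min_cases (x₀ i + (R - s)) (z i) with h' | h' <;> constructor <;> linarith

/-- The balls of radius larger than `ρ` contained in `ball x₀ R`. -/
def subBalls {n : ℕ} (x₀ : Fin n → ℝ) (R ρ : ℝ) : Set ((Fin n → ℝ) × ℝ) :=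
  {a | ρ < a.2 ∧ a.2 ≤ R ∧ ball a.1 a.2 ⊆ ball x₀ R}

theorem measure_goodLambda_le {n : ℕ} (f : (Fin n → ℝ) → ℝ) (x₀ : Fin n → ℝ) {R ρ : ℝ}
    (hρ : 0 ≤ ρ) (hρR : ρ < R) {l γ : ℝ≥0∞} (hl0 : l ≠ 0) (hl1 : l ≠ ∞)
    (hl : meanOn (fun y => ‖f y‖ₑ) (ball x₀ R) ≤ l) :
    volume {x | 2 * l < ballSup (subBalls x₀ R ρ) (meanOn fun y => ‖f y‖ₑ) x ∧
        ballSup (subBalls x₀ R ρ) (meanOsc f) x ≤ γ * l} ≤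
      65 ^ n * γ * volume {x | l < ballSup (subBalls x₀ R ρ) (meanOn fun y => ‖f y‖ₑ) x} := by
  set T := subBalls x₀ R ρ with hT
  set m := meanOn fun y => ‖f y‖ₑ with hm
  set bad := {x | 2 * l < ballSup T m x ∧ ballSup T (meanOsc f) x ≤ γ * l} with hbad
  set T₁ := {a ∈ T | l < m (ball a.1 a.2)} with hT₁
  set T₂ := {a ∈ T₁ | ∃ x ∈ ball a.1 a.2, ∀ b ∈ T₁, x ∈ ball b.1 b.2 → b.2 ≤ 2 * a.2} with hT₂
  have hTpos : ∀ a ∈ T, 0 < a.2 := fun a ha => hρ.trans_lt ha.1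
  have near : ∀ x, (∃ a ∈ T₁, x ∈ ball a.1 a.2) →
      ∃ a ∈ T₂, x ∈ ball a.1 a.2 ∧ ∀ b ∈ T₁, x ∈ ball b.1 b.2 → b.2 ≤ 2 * a.2 := by
    rintro x ⟨a₀, ha₀, hx₀⟩
    set Sx := {r : ℝ | ∃ z, (z, r) ∈ T₁ ∧ x ∈ ball z r}
    have hbdd : BddAbove Sx := ⟨R, by rintro r ⟨z, hz, -⟩; exact hz.1.2.1⟩
    have hmem : a₀.2 ∈ Sx := ⟨a₀.1, ha₀, hx₀⟩
    have hpos : 0 < sSup Sx := (hTpos _ ha₀.1).trans_le (le_csSup hbdd hmem)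
    obtain ⟨r, ⟨z, hz, hxz⟩, hr⟩ := exists_lt_of_lt_csSup ⟨_, hmem⟩ (half_lt_self hpos)
    have hall : ∀ b ∈ T₁, x ∈ ball b.1 b.2 → b.2 ≤ 2 * r := fun b hb hxb => by
      have := le_csSup hbdd (show b.2 ∈ Sx from ⟨b.1, hb, hxb⟩)
      linarith
    exact ⟨(z, r), ⟨hz, x, hxz, hall⟩, hxz, hall⟩
  obtain ⟨u, uT, uc, ud, hu⟩ := exists_disjoint_balls T₂ R
    fun a ha => ⟨hTpos a ha.1.1, ha.1.1.2.1⟩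
  have star : ∀ b ∈ u, ∃ c ∈ T, ball b.1 (13 * b.2) ∩ ball x₀ R ⊆ ball c.1 c.2 ∧
      c.2 ≤ 13 * b.2 ∧ m (ball c.1 c.2) ≤ l := by
    intro b hb
    obtain ⟨hb₁, x, hx, hmax⟩ := uT hb
    have hb0 := hTpos b hb₁.1
    have hbρ : ρ < b.2 := hb₁.1.1
    rcases le_or_gt R (13 * b.2) with h | h
    · exact ⟨(x₀, R), ⟨hρR, le_rfl, le_rfl⟩, Set.inter_subset_right, h, hl⟩
    · obtain ⟨z', h1, h2⟩ := exists_ball_translate_subset b.1 x₀ (by positivity) h.le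
      refine ⟨(z', 13 * b.2), ⟨by simp only; linarith, h.le, h2⟩, h1, le_rfl, ?_⟩
      by_contra! hlt
      have := hmax (z', 13 * b.2) ⟨⟨by simp only; linarith, h.le, h2⟩, hlt⟩
        (h1 ⟨ball_subset_ball (by linarith) hx, hb₁.1.2.2 hx⟩)
      simp only at this
      linarith
  set D : (Fin n → ℝ) × ℝ → Set (Fin n → ℝ) := fun b => {x ∈ bad | ∃ a ∈ T, x ∈ ball a.1 a.2 ∧
    ball a.1 a.2 ⊆ ball b.1 (13 * b.2) ∧ 2 * l < m (ball a.1 a.2)} with hD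
  have cover : bad ⊆ ⋃ b ∈ u, D b := by
    intro x hx
    obtain ⟨P, hP, hxP, hPl⟩ := lt_ballSup_iff.1 hx.1
    have hP₁ : P ∈ T₁ := ⟨hP, lt_of_le_of_lt (by rw [two_mul]; exact le_self_add) hPl⟩
    obtain ⟨a, ha, hxa, hamax⟩ := near x ⟨P, hP₁, hxP⟩
    obtain ⟨b, hb, ⟨w, hwa, hwb⟩, hab⟩ := hu a ha
    refine Set.mem_iUnion₂.2 ⟨b, hb, hx, P, hP, hxP, fun y hy => ?_, hPl⟩
    have hPa := hamax P hP₁ hxP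
    rw [mem_ball] at *
    have e1 := dist_triangle4 y P.1 x a.1
    have e2 := dist_triangle4 y a.1 w b.1
    rw [dist_comm P.1 x] at e1
    rw [dist_comm a.1 w] at e2
    linarith
  have hDb : ∀ b ∈ u, volume (D b) ≤ 65 ^ n * γ * volume (ball b.1 b.2) := by
    intro b hb
    rcases (D b).eq_empty_or_nonempty with h | ⟨y, hy⟩
    · rw [h]; simp
    obtain ⟨c, hc, hbc, hcr, hcl⟩ := star b hb
    have hb0 : 0 < b.2 := hTpos b (uT hb).1.1
    have hc0 : 0 < c.2 := hTpos c hc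
    have inball : ∀ a ∈ T, ball a.1 a.2 ⊆ ball b.1 (13 * b.2) → ball a.1 a.2 ⊆ ball c.1 c.2 :=
      fun a ha h => (Set.subset_inter h ha.2.2).trans hbc
    set f₀ := (volume (ball c.1 c.2)).toReal⁻¹ * ∫ z in ball c.1 c.2, f z with hf₀
    have hf₀l : ‖f₀‖ₑ ≤ l := (enorm_average_le _ _).trans hcl
    have hosc : meanOsc f (ball c.1 c.2) ≤ γ * l := by
      obtain ⟨hyb, a, ha, hya, hab, -⟩ := hy
      exact (le_ballSup hc (inball a ha hab hya)).trans hyb.2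
    set T₃ := {a ∈ T | ball a.1 a.2 ⊆ ball c.1 c.2 ∧
      l ≤ meanOn (fun y => ‖f y - f₀‖ₑ) (ball a.1 a.2)}
    have hDT : D b ⊆ ⋃ a ∈ T₃, ball a.1 a.2 := by
      rintro x ⟨-, a, ha, hxa, hab, hal⟩
      refine Set.mem_iUnion₂.2 ⟨a, ⟨ha, inball a ha hab, ?_⟩, hxa⟩
      have e : m (ball a.1 a.2) ≤ meanOn (fun y => ‖f y - f₀‖ₑ) (ball a.1 a.2) + l := by
        rw [← meanOn_add_const _ _ (volume_ball_ne_zero _ (hTpos a ha)) measure_ball_lt_top.ne]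
        refine meanOn_mono (fun y => ?_) _
        calc ‖f y‖ₑ = ‖(f y - f₀) + f₀‖ₑ := by rw [sub_add_cancel]
          _ ≤ _ := (enorm_add_le _ _).trans (by gcongr)
      have e2 := hal.le.trans e
      rw [two_mul] at e2
      exact (ENNReal.add_le_add_iff_right hl1).1 e2
    have hw := mul_volume_iUnion_ball_le (fun y => ‖f y - f₀‖ₑ) T₃ R
      (fun a ha => ⟨hTpos a ha.1, ha.1.2.1⟩) (fun a ha => ha.2.1) (fun a ha => ha.2.2)
    rw [← ENNReal.mul_le_mul_iff_right hl0 hl1]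
    calc l * volume (D b) ≤ l * volume (⋃ a ∈ T₃, ball a.1 a.2) := by gcongr
      _ ≤ 5 ^ n * ∫⁻ y in ball c.1 c.2, ‖f y - f₀‖ₑ := hw
      _ = 5 ^ n * (volume (ball c.1 c.2) * meanOsc f (ball c.1 c.2)) := by
          rw [meanOsc, volume_mul_meanOn _ (volume_ball_ne_zero _ hc0) measure_ball_lt_top.ne]
      _ ≤ 5 ^ n * (ENNReal.ofReal 13 ^ n * volume (ball b.1 b.2) * (γ * l)) := by
          gcongr
          exact volume_ball_le_mul hb0 hc0.le hcr _ _
      _ = l * (65 ^ n * γ * volume (ball b.1 b.2)) := by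
          rw [ENNReal.ofReal_ofNat, show (65 : ℝ≥0∞) = 5 * 13 by norm_num, mul_pow]; ring
  calc volume bad ≤ ∑' b : u, volume (D b) := (measure_mono cover).trans (measure_biUnion_le _ uc _)
    _ ≤ ∑' b : u, 65 ^ n * γ * volume (ball b.1.1 b.1.2) :=
        ENNReal.tsum_le_tsum fun b => hDb b.1 b.2
    _ = 65 ^ n * γ * volume (⋃ b ∈ u, ball b.1 b.2) := by
        rw [ENNReal.tsum_mul_left, measure_biUnion uc ud fun _ _ => measurableSet_ball]
    _ ≤ _ := by
        gcongr
        refine Set.iUnion₂_subset fun b hb x hx => ?_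
        exact lt_ballSup_iff.2 ⟨b, (uT hb).1.1, hx, (uT hb).1.2⟩

theorem ballSup_mono {n : ℕ} {T T' : Set ((Fin n → ℝ) × ℝ)} (h : T ⊆ T')
    (F : Set (Fin n → ℝ) → ℝ≥0∞) (x : Fin n → ℝ) : ballSup T F x ≤ ballSup T' F x :=
  biSup_mono fun _ ha => h ha

theorem ballSup_subBalls_eq_zero {n : ℕ} (x₀ : Fin n → ℝ) (R ρ : ℝ)
    (F : Set (Fin n → ℝ) → ℝ≥0∞) {x : Fin n → ℝ} (hx : x ∉ ball x₀ R) :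
    ballSup (subBalls x₀ R ρ) F x = 0 := by
  by_contra h
  obtain ⟨a, ha, hxa, -⟩ := lt_ballSup_iff.1 (pos_iff_ne_zero.2 h)
  exact hx (ha.2.2 hxa)

theorem meanOn_enorm_ne_top {n : ℕ} {f : (Fin n → ℝ) → ℝ} {B : Set (Fin n → ℝ)}
    (h0 : volume B ≠ 0) (hf : IntegrableOn f B) : meanOn (fun y => ‖f y‖ₑ) B ≠ ∞ :=
  ENNReal.mul_ne_top (ENNReal.inv_ne_top.2 h0) hf.2.ne

/-- The local Fefferman–Stein inequality on a cube. -/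
theorem exists_lintegral_ballSup_subBalls_le (n : ℕ) {p : ℝ} (hp : 0 < p) :
    ∃ C : ℝ≥0∞, C ≠ ∞ ∧ ∀ (f : (Fin n → ℝ) → ℝ) (x₀ : Fin n → ℝ) (R ρ : ℝ), 0 ≤ ρ → ρ < R →
      IntegrableOn f (ball x₀ R) →
      ∫⁻ x, ballSup (subBalls x₀ R ρ) (meanOn fun y => ‖f y‖ₑ) x ^ p ≤
        C * (meanOn (fun y => ‖f y‖ₑ) (ball x₀ R) ^ p * volume (ball x₀ R) +
          ∫⁻ x in ball x₀ R, ballSup (subBalls x₀ R ρ) (meanOsc f) x ^ p) := by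
  set γ : ℝ := (2 ^ p)⁻¹ / 2 / 65 ^ n with hγ
  have hγ0 : 0 < γ := by positivity
  refine ⟨ENNReal.ofReal (2 * 2 ^ p) * (1 + ENNReal.ofReal ((γ ^ p)⁻¹)), by finiteness, ?_⟩
  intro f x₀ R ρ hρ hρR hf
  set m := meanOn fun y => ‖f y‖ₑ
  set T := subBalls x₀ R ρ
  have hR : 0 < R := hρ.trans_lt hρR
  have hfin : m (ball x₀ R) ≠ ∞ := meanOn_enorm_ne_top (volume_ball_ne_zero _ hR) hf
  have : IsFiniteMeasure (volume.restrict (ball x₀ R)) :=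
    ⟨by rw [Measure.restrict_apply_univ]; exact measure_ball_lt_top⟩
  have main := lintegral_rpow_le_of_goodLambda (volume.restrict (ball x₀ R))
    (measurable_ballSup T m) (measurable_ballSup T (meanOsc f)) hp
    (a := (m (ball x₀ R)).toReal) ENNReal.toReal_nonneg hγ0 (fun l hal hl => by
      have h1 := measure_goodLambda_le f x₀ hρ hρR (l := ENNReal.ofReal l)
        (γ := ENNReal.ofReal γ) (by simpa using hl) ENNReal.ofReal_ne_top
        (ENNReal.le_ofReal_iff_toReal_le hfin hl.le |>.2 hal)
      have h2 : volume {x | ENNReal.ofReal l < ballSup T m x} =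
          volume.restrict (ball x₀ R) {x | ENNReal.ofReal l < ballSup T m x} := by
        have hms : MeasurableSet {x | ENNReal.ofReal l < ballSup T m x} :=
          measurable_ballSup T m measurableSet_Ioi
        rw [Measure.restrict_apply hms,
          Set.inter_eq_left.2]
        intro x hx
        by_contra h
        rw [Set.mem_ofPred_eq, ballSup_subBalls_eq_zero _ _ _ _ h] at hx
        exact absurd hx (by simp)
      rw [ENNReal.ofReal_mul (by norm_num), ENNReal.ofReal_mul hγ0.le, ENNReal.ofReal_ofNat, ← h2]
      refine (Measure.restrict_apply_le _ _).trans (h1.trans_eq ?_)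
      congr 1
      rw [hγ, ENNReal.ofReal_div_of_pos (by positivity), ENNReal.ofReal_pow (by norm_num),
        ENNReal.ofReal_ofNat]
      exact ENNReal.mul_div_cancel (by simp) (by finiteness))
  have hsupp : ∫⁻ x, ballSup T m x ^ p = ∫⁻ x in ball x₀ R, ballSup T m x ^ p := by
    symm
    rw [← lintegral_indicator measurableSet_ball]
    refine lintegral_congr fun x => ?_
    by_cases hx : x ∈ ball x₀ R
    · rw [Set.indicator_of_mem hx]
    · rw [Set.indicator_of_notMem hx, ballSup_subBalls_eq_zero _ _ _ _ hx,
        ENNReal.zero_rpow_of_pos hp]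
  rw [hsupp]
  refine main.trans ?_
  rw [mul_assoc, Measure.restrict_apply_univ, ← ENNReal.ofReal_rpow_of_nonneg
    ENNReal.toReal_nonneg hp.le, ENNReal.ofReal_toReal hfin]
  gcongr
  rw [add_mul, one_mul, mul_add]
  gcongr
  · exact le_self_add
  · exact le_add_self

/-- The global Fefferman–Stein inequality, for the maximal functions over all cubes that are not
too small. -/
theorem exists_lintegral_ballSup_le (n : ℕ) (hn : 1 ≤ n) {q : ℝ} (hq : 0 < q) :
    ∃ C : ℝ≥0∞, C ≠ ∞ ∧ ∀ (f : (Fin n → ℝ) → ℝ) (ρ : ℝ), 0 ≤ ρ →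
      (∀ z r, IntegrableOn f (ball z r)) →
      ∫⁻ x, ballSup {a | ρ < a.2} (meanOn fun y => ‖f y‖ₑ) x ^ q ≠ ∞ →
      ∫⁻ x, ballSup {a | ρ < a.2} (meanOn fun y => ‖f y‖ₑ) x ^ q ≤
        C * ∫⁻ x, ballSup {a | ρ < a.2} (meanOsc f) x ^ q := by
  obtain ⟨C, hC, h⟩ := exists_lintegral_ballSup_subBalls_le n hq
  refine ⟨C, hC, fun f ρ hρ hf hfin => ?_⟩
  set m := meanOn fun y => ‖f y‖ₑ
  set T : Set ((Fin n → ℝ) × ℝ) := {a | ρ < a.2}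
  set A := ballSup T m with hA
  set TK : ℕ → Set ((Fin n → ℝ) × ℝ) := fun K => subBalls 0 K ρ with hTK
  have hTKT : ∀ K, TK K ⊆ T := fun K a ha => ha.1
  have hTmono : Monotone TK := fun K K' hK a ha =>
    ⟨ha.1, ha.2.1.trans (Nat.cast_le.2 hK), ha.2.2.trans (ball_subset_ball (Nat.cast_le.2 hK))⟩
  have hmono : Monotone fun K => ∫⁻ x, ballSup (TK K) m x ^ q := fun K K' hK =>
    lintegral_mono fun x => ENNReal.rpow_le_rpow (ballSup_mono (hTmono hK) m x) hq.le
  have hsup : ∫⁻ x, A x ^ q = ⨆ K, ∫⁻ x, ballSup (TK K) m x ^ q := by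
    rw [← lintegral_iSup (fun K => (measurable_ballSup _ _).pow_const q)
      (fun K K' hK x => ENNReal.rpow_le_rpow (ballSup_mono (hTmono hK) m x) hq.le)]
    refine lintegral_congr fun x => ?_
    have e := (ENNReal.orderIsoRpow q hq).map_iSup (fun K => ballSup (TK K) m x)
    simp only [ENNReal.orderIsoRpow_apply] at e
    rw [← e]
    congr 1
    refine le_antisymm (le_of_forall_lt fun l hl => ?_)
      (iSup_le fun K => ballSup_mono (hTKT K) m x)
    obtain ⟨a, ha, hxa, hla⟩ := lt_ballSup_iff.1 hl
    obtain ⟨K, hK⟩ := exists_nat_ge (max a.2 (dist a.1 0 + a.2))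
    refine lt_iSup_iff.2 ⟨K, lt_ballSup_iff.2 ⟨a, ⟨ha, (le_max_left _ _).trans hK, ?_⟩, hxa, hla⟩⟩
    refine ball_subset_ball' ?_
    linarith [(le_max_right _ _).trans hK]
  have htail : Filter.Tendsto (fun K : ℕ => ∫⁻ x in (ball (0 : Fin n → ℝ) K)ᶜ, A x ^ q)
      Filter.atTop (nhds 0) := by
    have hmeas : ∀ K : ℕ, MeasurableSet (ball (0 : Fin n → ℝ) K)ᶜ := fun K => measurableSet_ball.compl
    have e := tendsto_measure_iInter_atTop (μ := volume.withDensity fun x => A x ^ q)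
      (s := fun K : ℕ => (ball (0 : Fin n → ℝ) K)ᶜ) (fun K => (hmeas K).nullMeasurableSet)
      (fun K K' hK => Set.compl_subset_compl.2 (ball_subset_ball (Nat.cast_le.2 hK)))
      ⟨0, by
        rw [withDensity_apply _ (hmeas 0)]
        exact ne_top_of_le_ne_top hfin (setLIntegral_le_lintegral _ _)⟩
    have e2 : ⋂ K : ℕ, (ball (0 : Fin n → ℝ) K)ᶜ = ∅ := by
      rw [← Set.compl_iUnion, iUnion_ball_nat, Set.compl_univ]
    rw [e2, measure_empty] at e
    refine e.congr fun K => withDensity_apply _ (hmeas K)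
  have hbound : ∀ K : ℕ, ρ < K → m (ball 0 K) ^ q * volume (ball (0 : Fin n → ℝ) K) ≤
      (2 ^ n) ^ q * ∫⁻ x in (ball (0 : Fin n → ℝ) K)ᶜ, A x ^ q := by
    intro K hK
    have hK0 : (0 : ℝ) < K := hρ.trans_lt hK
    set B : Set (Fin n → ℝ) := ball 0 K
    set B' : Set (Fin n → ℝ) := ball 0 (2 * K)
    have hBB' : B ⊆ B' := ball_subset_ball (by linarith)
    have hvol : volume B ≤ volume (B' \ B) := by
      rw [measure_sdiff hBB' measurableSet_ball.nullMeasurableSet measure_ball_lt_top.ne]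
      refine ENNReal.le_sub_of_add_le_right measure_ball_lt_top.ne ?_
      rw [← two_mul, Real.volume_pi_ball _ hK0, Real.volume_pi_ball _ (by positivity),
        ← ENNReal.ofReal_ofNat, ← ENNReal.ofReal_mul (by norm_num), mul_pow 2 (2 * (K : ℝ)),
        Fintype.card_fin]
      refine ENNReal.ofReal_le_ofReal ?_
      gcongr
      exact le_self_pow₀ (by norm_num) (by omega)
    calc m B ^ q * volume B ≤ m B ^ q * volume (B' \ B) := by gcongr
      _ = ∫⁻ x in B' \ B, m B ^ q := by rw [setLIntegral_const]
      _ ≤ ∫⁻ x in B' \ B, (2 ^ n) ^ q * A x ^ q := by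
        refine setLIntegral_mono' (measurableSet_ball.diff measurableSet_ball) fun x hx => ?_
        rw [← ENNReal.mul_rpow_of_nonneg _ _ hq.le]
        refine ENNReal.rpow_le_rpow ?_ hq.le
        calc m B ≤ 2 ^ n * m B' := by
              refine meanOn_le_mul _ hBB' (volume_ball_ne_zero _ hK0) measure_ball_lt_top.ne ?_
              rw [← ENNReal.ofReal_ofNat]
              exact volume_ball_le_mul hK0 (by positivity) le_rfl _ _
          _ ≤ _ := by
              gcongr
              exact le_ballSup (show ρ < 2 * K by linarith) hx.1
      _ ≤ ∫⁻ x in Bᶜ, (2 ^ n) ^ q * A x ^ q := lintegral_mono_set fun x hx => hx.2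
      _ = _ := lintegral_const_mul _ ((measurable_ballSup _ _).pow_const q)
  rw [hsup]
  refine le_of_tendsto_of_tendsto (tendsto_atTop_iSup hmono) (b := Filter.atTop)
    (g := fun K : ℕ => C * ((2 ^ n) ^ q * (∫⁻ x in (ball (0 : Fin n → ℝ) K)ᶜ, A x ^ q) +
      ∫⁻ x, ballSup T (meanOsc f) x ^ q)) ?_ ?_
  · have h2 : ((2 : ℝ≥0∞) ^ n) ^ q ≠ ∞ := by finiteness
    have e := ENNReal.Tendsto.const_mul (a := C) (((ENNReal.Tendsto.const_mul htail
      (Or.inr h2)).add_const (∫⁻ x, ballSup T (meanOsc f) x ^ q))) (Or.inr hC)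
    simpa using e
  · obtain ⟨K₀, hK₀⟩ := exists_nat_gt ρ
    filter_upwards [Filter.eventually_ge_atTop K₀] with K hK
    have hρK : ρ < K := hK₀.trans_le (Nat.cast_le.2 hK)
    refine (h f 0 K ρ hρ hρK (hf _ _)).trans ?_
    refine mul_le_mul_right (add_le_add (hbound K hρK) ?_) C
    exact (setLIntegral_le_lintegral _ _).trans
      (lintegral_mono fun x => ENNReal.rpow_le_rpow (ballSup_mono (hTKT K) _ x) hq.le)

/-- The supremum of `F` over the closed balls that contain `x`. -/
def closedBallSup {n : ℕ} (F : Set (Fin n → ℝ) → ℝ≥0∞) (x : Fin n → ℝ) : ℝ≥0∞ :=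
  ⨆ (z : Fin n → ℝ) (r : ℝ) (_ : 0 < r) (_ : x ∈ closedBall z (r / 2)), F (closedBall z (r / 2))

theorem le_closedBallSup {n : ℕ} (F : Set (Fin n → ℝ) → ℝ≥0∞) {x z : Fin n → ℝ} {s : ℝ}
    (hs : 0 < s) (hx : x ∈ closedBall z s) : F (closedBall z s) ≤ closedBallSup F x := by
  have e : 2 * s / 2 = s := by ring
  have := le_iSup₂_of_le (f := fun (z : Fin n → ℝ) (r : ℝ) =>
    ⨆ (_ : 0 < r) (_ : x ∈ closedBall z (r / 2)), F (closedBall z (r / 2))) z (2 * s)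
    (le_iSup₂_of_le (by positivity) (by rwa [e]) le_rfl)
  rwa [e] at this

theorem meanOn_closedBall_le {n : ℕ} (g : (Fin n → ℝ) → ℝ≥0∞) {z z' : Fin n → ℝ} {s s' c : ℝ}
    (hs : 0 < s) (hs' : 0 ≤ s') (hc : s' ≤ c * s) (h : closedBall z s ⊆ ball z' s') :
    meanOn g (closedBall z s) ≤ ENNReal.ofReal c ^ n * meanOn g (ball z' s') :=
  meanOn_le_mul g h (measure_closedBall_pos _ _ hs).ne' measure_ball_lt_top.ne
    ((volume_ball_le_mul hs hs' hc z z').trans (by gcongr; exact ball_subset_closedBall))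

theorem meanOn_ball_le {n : ℕ} (g : (Fin n → ℝ) → ℝ≥0∞) {z z' : Fin n → ℝ} {s s' c : ℝ}
    (hs : 0 < s) (hs' : 0 ≤ s') (hc : s' ≤ c * s) (h : ball z s ⊆ closedBall z' s') :
    meanOn g (ball z s) ≤ ENNReal.ofReal c ^ n * meanOn g (closedBall z' s') :=
  meanOn_le_mul g h (volume_ball_ne_zero _ hs) measure_closedBall_lt_top.ne
    (volume_closedBall_le_mul hs hs' hc z z')

theorem closedBallSup_meanOn_le {n : ℕ} (g : (Fin n → ℝ) → ℝ≥0∞) {x y : Fin n → ℝ} {t : ℝ}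
    (ht : 0 < t) (hy : y ∈ closedBall x (t / 2)) :
    closedBallSup (meanOn g) y ≤ 2 ^ n * ballSup (subBalls x (2 * t) 0) (meanOn g) y +
      4 ^ n * ballSup {a | t < a.2} (meanOn g) x := by
  refine iSup₂_le fun z r => iSup₂_le fun hr hyz => ?_
  have hs : 0 < r / 2 := by positivity
  rw [mem_closedBall] at hy hyz
  have hxz := dist_triangle_left z x y
  rcases le_or_gt r t with hrt | hrt
  · have hsub : closedBall z (r / 2) ⊆ ball z r := closedBall_subset_ball (by linarith)
    refine le_trans ?_ le_self_add
    refine (meanOn_closedBall_le g (c := 2) hs hr.le (by linarith) hsub).trans ?_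
    rw [ENNReal.ofReal_ofNat]
    gcongr
    refine le_ballSup ⟨hr, by simp only; linarith, ball_subset_ball' ?_⟩ (hsub hyz)
    linarith
  · refine le_trans ?_ le_add_self
    refine (meanOn_closedBall_le g (c := 4) (z' := z) (s' := 2 * r) hs (by positivity)
      (by linarith) (closedBall_subset_ball (by linarith))).trans ?_
    rw [ENNReal.ofReal_ofNat]
    gcongr
    refine le_ballSup (show t < 2 * r by linarith) ?_
    rw [mem_ball, dist_comm]
    linarith

theorem ballSup_meanOn_le {n : ℕ} (g : (Fin n → ℝ) → ℝ≥0∞) {x y : Fin n → ℝ} {t : ℝ}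
    (ht : 0 < t) (hy : y ∈ closedBall x (t / 2)) :
    ballSup {a | t < a.2} (meanOn g) x ≤ 2 ^ n * closedBallSup (meanOn g) y := by
  refine iSup₂_le fun a ha => iSup_le fun hxa => ?_
  have ha0 : 0 < a.2 := ht.trans ha
  have ha' : t < a.2 := ha
  refine (meanOn_ball_le g (c := 2) (z' := a.1) (s' := 2 * a.2) ha0 (by positivity) le_rfl
    fun w hw => ?_).trans ?_
  · rw [mem_ball] at hw
    rw [mem_closedBall]
    linarith
  · rw [ENNReal.ofReal_ofNat]
    gcongr
    refine le_closedBallSup _ (by positivity) ?_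
    rw [mem_closedBall] at *
    rw [mem_ball] at hxa
    linarith [dist_triangle y x a.1]

theorem ballSup_meanOsc_le_of_mem {n : ℕ} {f : (Fin n → ℝ) → ℝ}
    (hf : ∀ z r, IntegrableOn f (closedBall z r)) {x y : Fin n → ℝ} {t : ℝ}
    (ht : 0 < t) (hy : y ∈ closedBall x (t / 2)) :
    ballSup {a | t < a.2} (meanOsc f) x ≤ 2 * 2 ^ n * ballSup {a | 0 < a.2} (meanOsc f) y := by
  refine iSup₂_le fun a ha => iSup_le fun hxa => ?_
  have ha0 : 0 < a.2 := ht.trans ha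
  have ha' : t < a.2 := ha
  refine (meanOsc_le_mul f (B' := ball a.1 (2 * a.2)) (K := 2 ^ n)
    (ball_subset_ball (by linarith)) (volume_ball_ne_zero _ ha0) measure_ball_lt_top.ne ?_
    ((hf _ _).mono_set ball_subset_closedBall)).trans ?_
  · rw [← ENNReal.ofReal_ofNat]
    exact volume_ball_le_mul ha0 (by positivity) le_rfl _ _
  · gcongr
    refine le_ballSup (show 0 < 2 * a.2 by positivity) ?_
    rw [mem_closedBall] at hy
    rw [mem_ball] at *
    linarith [dist_triangle y x a.1]

theorem ballSup_meanOsc_le_closedBallSup {n : ℕ} {f : (Fin n → ℝ) → ℝ}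
    (hf : ∀ z r, IntegrableOn f (closedBall z r)) (y : Fin n → ℝ) :
    ballSup {a | 0 < a.2} (meanOsc f) y ≤ 2 * closedBallSup (meanOsc f) y := by
  refine iSup₂_le fun a ha => iSup_le fun hya => ?_
  have ha0 : 0 < a.2 := ha
  refine (meanOsc_le_mul f (K := 1) ball_subset_closedBall (volume_ball_ne_zero _ ha0)
    measure_closedBall_lt_top.ne ?_ (hf _ _)).trans ?_
  · simpa using volume_closedBall_le_mul (c := 1) ha0 ha0.le (by linarith) a.1 a.1
  · rw [mul_one]
    gcongr
    exact le_closedBallSup _ ha0 (ball_subset_closedBall hya)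

theorem add_rpow_le_two_rpow_mul (a b : ℝ≥0∞) {p : ℝ} (hp : 0 ≤ p) :
    (a + b) ^ p ≤ 2 ^ p * (a ^ p + b ^ p) := by
  have h : (2 * max a b) ^ p ≤ 2 ^ p * (a ^ p + b ^ p) := by
    rw [ENNReal.mul_rpow_of_nonneg _ _ hp]
    gcongr
    rcases max_choice a b with h | h <;> rw [h]
    exacts [le_self_add, le_add_self]
  refine le_trans (ENNReal.rpow_le_rpow ?_ hp) h
  rw [two_mul]
  exact add_le_add (le_max_left _ _) (le_max_right _ _)

theorem sum_rpow_le_card_rpow_mul {ι : Type*} (s : Finset ι) (a : ι → ℝ≥0∞) {p : ℝ} (hp : 0 < p) :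
    (∑ i ∈ s, a i) ^ p ≤ (s.card : ℝ≥0∞) ^ p * ∑ i ∈ s, a i ^ p := by
  rcases s.eq_empty_or_nonempty with rfl | hs
  · simp [hp]
  obtain ⟨j, hj, hmax⟩ := s.exists_max_image a hs
  calc (∑ i ∈ s, a i) ^ p ≤ ((s.card : ℝ≥0∞) * a j) ^ p := by
        refine ENNReal.rpow_le_rpow ?_ hp.le
        rw [← nsmul_eq_mul]
        exact Finset.sum_le_card_nsmul _ _ _ hmax
    _ = (s.card : ℝ≥0∞) ^ p * a j ^ p := ENNReal.mul_rpow_of_nonneg _ _ hp.le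
    _ ≤ _ := by
        gcongr
        exact Finset.single_le_sum (f := fun i => a i ^ p) (fun _ _ => zero_le) hj

theorem rpow_le_mul_meanOn_rpow {n : ℕ} {g : (Fin n → ℝ) → ℝ≥0∞} {B : Set (Fin n → ℝ)}
    {c K : ℝ≥0∞} {p q : ℝ} (hp : 0 < p) (hq : 0 ≤ q) (hB : MeasurableSet B)
    (h0 : volume B ≠ 0) (h1 : volume B ≠ ∞) (hK : K ≠ ∞) (h : ∀ y ∈ B, c ≤ K * g y) :
    c ^ q ≤ K ^ q * meanOn (fun y => g y ^ p) B ^ (q / p) := by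
  have key : c ^ p ≤ K ^ p * meanOn (fun y => g y ^ p) B := by
    calc c ^ p = (volume B)⁻¹ * ∫⁻ _ in B, c ^ p := by
          rw [setLIntegral_const, mul_comm (c ^ p), ← mul_assoc, ENNReal.inv_mul_cancel h0 h1,
            one_mul]
      _ ≤ (volume B)⁻¹ * ∫⁻ y in B, K ^ p * g y ^ p := by
          gcongr 1
          refine setLIntegral_mono' hB fun y hy => ?_
          rw [← ENNReal.mul_rpow_of_nonneg _ _ hp.le]
          exact ENNReal.rpow_le_rpow (h y hy) hp.le
      _ = _ := by
          rw [lintegral_const_mul' _ _ (ENNReal.rpow_ne_top_of_nonneg hp.le hK), meanOn]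
          ring
  have e : p * (q / p) = q := by field_simp
  have := ENNReal.rpow_le_rpow key (div_nonneg hq hp.le)
  rwa [ENNReal.mul_rpow_of_nonneg _ _ (div_nonneg hq hp.le), ← ENNReal.rpow_mul,
    ← ENNReal.rpow_mul, e] at this

theorem measurable_meanOn_closedBall {n : ℕ} {g : (Fin n → ℝ) → ℝ≥0∞} (hg : Measurable g)
    {s : ℝ} (hs : 0 ≤ s) : Measurable fun x => meanOn g (closedBall x s) := by
  have hD : MeasurableSet {a : (Fin n → ℝ) × (Fin n → ℝ) | dist a.2 a.1 ≤ s} :=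
    measurableSet_le (measurable_snd.dist measurable_fst) measurable_const
  have h := ((hg.comp measurable_snd).indicator hD).lintegral_prod_right' (ν := volume)
  simp only [meanOn, Real.volume_pi_closedBall _ hs]
  refine Measurable.const_mul ?_ _
  convert h using 2 with x
  rw [← lintegral_indicator measurableSet_closedBall]
  rfl

theorem exists_finset_ball_subset (n : ℕ) : ∃ F : Finset (Fin n → ℝ), ∀ (x : Fin n → ℝ) (t : ℝ),
    0 < t → ball x (2 * t) ⊆ ⋃ v ∈ F, closedBall (x + t • v) (t / 2) := by
  obtain ⟨S, -, hS, hcov⟩ :=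
    (isCompact_closedBall (0 : Fin n → ℝ) 2).finite_cover_balls (e := 1 / 2) (by norm_num)
  refine ⟨hS.toFinset, fun x t ht y hy => ?_⟩
  have hw : t⁻¹ • (y - x) ∈ closedBall (0 : Fin n → ℝ) 2 := by
    rw [mem_ball, dist_eq_norm] at hy
    rw [mem_closedBall, dist_zero_right, norm_smul, norm_inv, Real.norm_of_nonneg ht.le,
      inv_mul_le_iff₀ ht]
    linarith
  obtain ⟨v, hv, hvw⟩ := Set.mem_iUnion₂.1 (hcov hw)
  refine Set.mem_iUnion₂.2 ⟨v, hS.mem_toFinset.2 hv, ?_⟩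
  have e : y - (x + t • v) = t • (t⁻¹ • (y - x) - v) := by
    rw [smul_sub, smul_inv_smul₀ ht.ne']
    abel
  rw [mem_ball, dist_eq_norm] at hvw
  rw [mem_closedBall, dist_eq_norm, e, norm_smul, Real.norm_of_nonneg ht.le]
  nlinarith

theorem exists_meanOn_closedBallSup_rpow_le (n : ℕ) {p : ℝ} (hp : 0 < p) :
    ∃ C : ℝ≥0∞, C ≠ ∞ ∧ ∃ F : Finset (Fin n → ℝ), ∀ (f : (Fin n → ℝ) → ℝ) (x : Fin n → ℝ) (t : ℝ),
      0 < t → (∀ z r, IntegrableOn f (closedBall z r)) →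
      meanOn (fun y => closedBallSup (meanOn fun y => ‖f y‖ₑ) y ^ p) (closedBall x (t / 2)) ≤
        C * (ballSup {a | t < a.2} (meanOn fun y => ‖f y‖ₑ) x ^ p + ∑ v ∈ F,
          meanOn (fun y => ballSup {a | 0 < a.2} (meanOsc f) y ^ p)
            (closedBall (x + t • v) (t / 2))) := by
  obtain ⟨C, hC, hloc⟩ := exists_lintegral_ballSup_subBalls_le n hp
  obtain ⟨F, hF⟩ := exists_finset_ball_subset n
  refine ⟨2 ^ p * ((2 ^ n) ^ p * (C * 4 ^ n) + (4 ^ n) ^ p), by finiteness, F,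
    fun f x t ht hf => ?_⟩
  set m := meanOn fun y => ‖f y‖ₑ with hm
  set A := ballSup {a | t < a.2} m x
  set s : (Fin n → ℝ) → ℝ≥0∞ := fun y => ballSup {a | 0 < a.2} (meanOsc f) y ^ p
  set B := closedBall x (t / 2) with hB
  set V := volume B
  have hV0 : V ≠ 0 := (measure_closedBall_pos _ _ (by positivity)).ne'
  have hV1 : V ≠ ∞ := measure_closedBall_lt_top.ne
  have hVv : ∀ v, volume (closedBall (x + t • v) (t / 2)) = V := fun v => by
    simp only [V, hB, Real.volume_pi_closedBall _ (half_pos ht).le]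
  set W := ∑ v ∈ F, meanOn s (closedBall (x + t • v) (t / 2)) with hW
  have hvol : volume (ball x (2 * t)) ≤ 4 ^ n * V := by
    have := volume_ball_le_mul (c := 4) (half_pos ht) (by positivity) (by linarith : 2 * t ≤ _) x x
    rw [ENNReal.ofReal_ofNat] at this
    exact this.trans (mul_le_mul_right (measure_mono ball_subset_closedBall) _)
  have hmA : m (ball x (2 * t)) ≤ A :=
    le_ballSup (show t < 2 * t by linarith) (mem_ball_self (by positivity))
  have hosc : ∫⁻ y in ball x (2 * t), ballSup (subBalls x (2 * t) 0) (meanOsc f) y ^ p ≤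
      V * W := by
    calc _ ≤ ∫⁻ y in ball x (2 * t), s y :=
          lintegral_mono fun y => ENNReal.rpow_le_rpow
            (ballSup_mono (fun a ha => ha.1) _ y) hp.le
      _ ≤ ∫⁻ y in ⋃ v ∈ F, closedBall (x + t • v) (t / 2), s y :=
          lintegral_mono_set (hF x t ht)
      _ ≤ ∑ v ∈ F, ∫⁻ y in closedBall (x + t • v) (t / 2), s y := by
          have hbi : (⋃ v ∈ F, closedBall (x + t • v) (t / 2)) =
              ⋃ v : F, closedBall (x + t • v.1) (t / 2) := Set.biUnion_eq_iUnion _ _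
          rw [hbi]
          refine (lintegral_iUnion_le _ _).trans_eq ?_
          rw [tsum_fintype]
          exact Finset.sum_coe_sort F fun v => ∫⁻ y in closedBall (x + t • v) (t / 2), s y
      _ = V * W := by
          rw [hW, Finset.mul_sum]
          refine Finset.sum_congr rfl fun v _ => ?_
          rw [← hVv v, volume_mul_meanOn _ (by rwa [hVv]) (by rwa [hVv])]
  have hS : ∫⁻ y in B, ballSup (subBalls x (2 * t) 0) m y ^ p ≤
      C * 4 ^ n * (V * (A ^ p + W)) := by
    calc _ ≤ ∫⁻ y, ballSup (subBalls x (2 * t) 0) m y ^ p := setLIntegral_le_lintegral _ _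
      _ ≤ C * (m (ball x (2 * t)) ^ p * volume (ball x (2 * t)) + _) :=
          hloc f x (2 * t) 0 le_rfl (by positivity) ((hf _ _).mono_set ball_subset_closedBall)
      _ ≤ C * (A ^ p * (4 ^ n * V) + 4 ^ n * (V * W)) := by
          gcongr
          exact hosc.trans (le_mul_of_one_le_left' (one_le_pow₀ (by norm_num)))
      _ = _ := by ring
  rw [meanOn, ← ENNReal.div_eq_inv_mul, ENNReal.div_le_iff hV0 hV1]
  calc ∫⁻ y in B, closedBallSup m y ^ p
      ≤ ∫⁻ y in B, 2 ^ p * ((2 ^ n) ^ p * ballSup (subBalls x (2 * t) 0) m y ^ p +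
          (4 ^ n) ^ p * A ^ p) := by
        refine setLIntegral_mono' measurableSet_closedBall fun y hy => ?_
        refine (ENNReal.rpow_le_rpow (closedBallSup_meanOn_le _ ht hy) hp.le).trans ?_
        refine (add_rpow_le_two_rpow_mul _ _ hp.le).trans_eq ?_
        rw [ENNReal.mul_rpow_of_nonneg _ _ hp.le, ENNReal.mul_rpow_of_nonneg _ _ hp.le]
    _ = 2 ^ p * ((2 ^ n) ^ p * ∫⁻ y in B, ballSup (subBalls x (2 * t) 0) m y ^ p) +
          2 ^ p * ((4 ^ n) ^ p * A ^ p * V) := by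
        rw [lintegral_const_mul' _ _ (by finiteness), lintegral_add_right _ measurable_const,
          lintegral_const_mul' _ _ (by finiteness), setLIntegral_const, mul_add]
    _ ≤ 2 ^ p * ((2 ^ n) ^ p * (C * 4 ^ n * (V * (A ^ p + W)))) +
          2 ^ p * ((4 ^ n) ^ p * (A ^ p + W) * V) := by
        gcongr
        exact le_self_add
    _ = _ := by ring

theorem exists_lintegral_meanOn_closedBallSup_le (n : ℕ) (hn : 1 ≤ n) {p q : ℝ} (hp : 0 < p)
    (hq : 0 < q) : ∃ C : ℝ≥0∞, C ≠ ∞ ∧ ∀ (f : (Fin n → ℝ) → ℝ) (t : ℝ), 0 < t →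
      (∀ z r, IntegrableOn f (closedBall z r)) →
      ∫⁻ x, meanOn (fun y => closedBallSup (meanOn fun y => ‖f y‖ₑ) y ^ p)
        (closedBall x (t / 2)) ^ (q / p) ≠ ∞ →
      ∫⁻ x, meanOn (fun y => closedBallSup (meanOn fun y => ‖f y‖ₑ) y ^ p)
        (closedBall x (t / 2)) ^ (q / p) ≤
        C * ∫⁻ x, meanOn (fun y => closedBallSup (meanOsc f) y ^ p)
          (closedBall x (t / 2)) ^ (q / p) := by
  obtain ⟨C₁, hC₁, F, hloc⟩ := exists_meanOn_closedBallSup_rpow_le n hp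
  obtain ⟨C₂, hC₂, hglob⟩ := exists_lintegral_ballSup_le n hn hq
  have hqp : 0 < q / p := div_pos hq hp
  have e : p * (q / p) = q := by field_simp
  refine ⟨C₁ ^ (q / p) * 2 ^ (q / p) * (C₂ * (2 * 2 ^ n) ^ q + (F.card : ℝ≥0∞) ^ (q / p) * F.card) *
    2 ^ q, by finiteness, fun f t ht hf hfin => ?_⟩
  set m := meanOn fun y => ‖f y‖ₑ with hm
  set A := ballSup {a | t < a.2} m with hA
  set s : (Fin n → ℝ) → ℝ≥0∞ := ballSup {a | 0 < a.2} (meanOsc f) with hs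
  set Φ : (Fin n → ℝ) → ℝ≥0∞ := fun x => meanOn (fun y => s y ^ p) (closedBall x (t / 2)) with hΦ
  have hV0 : ∀ x : Fin n → ℝ, volume (closedBall x (t / 2)) ≠ 0 := fun x =>
    (measure_closedBall_pos _ _ (by positivity)).ne'
  have hV1 : ∀ x : Fin n → ℝ, volume (closedBall x (t / 2)) ≠ ∞ := fun x =>
    measure_closedBall_lt_top.ne
  have hΦm : Measurable Φ :=
    measurable_meanOn_closedBall ((measurable_ballSup _ _).pow_const p) (half_pos ht).le
  have hAm : Measurable A := measurable_ballSup _ _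
  have hAfin : ∫⁻ x, A x ^ q ≠ ∞ := by
    refine ne_top_of_le_ne_top (ENNReal.mul_ne_top (a := (2 ^ n) ^ q) (by finiteness) hfin) ?_
    rw [← lintegral_const_mul' _ _ (by finiteness)]
    exact lintegral_mono fun x => rpow_le_mul_meanOn_rpow hp hq.le measurableSet_closedBall (hV0 x)
      (hV1 x) (by finiteness) fun y hy => ballSup_meanOn_le _ ht hy
  have hAle : ∫⁻ x, A x ^ q ≤ C₂ * (2 * 2 ^ n) ^ q * ∫⁻ x, Φ x ^ (q / p) := by
    refine (hglob f t ht.le (fun z r => (hf z r).mono_set ball_subset_closedBall) hAfin).trans ?_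
    rw [mul_assoc, ← lintegral_const_mul' ((2 * 2 ^ n) ^ q) _ (by finiteness)]
    refine mul_le_mul_right (lintegral_mono fun x => ?_) _
    exact rpow_le_mul_meanOn_rpow hp hq.le measurableSet_closedBall (hV0 x)
      (hV1 x) (by finiteness) fun y hy => ballSup_meanOsc_le_of_mem hf ht hy
  have hΦle : ∫⁻ x, Φ x ^ (q / p) ≤ 2 ^ q * ∫⁻ x, meanOn (fun y => closedBallSup (meanOsc f) y ^ p)
      (closedBall x (t / 2)) ^ (q / p) := by
    rw [← lintegral_const_mul' _ _ (by finiteness)]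
    refine lintegral_mono fun x => ?_
    have h2 : (2 : ℝ≥0∞) ^ q = (2 ^ p) ^ (q / p) := by rw [← ENNReal.rpow_mul, e]
    rw [h2, ← ENNReal.mul_rpow_of_nonneg _ _ hqp.le]
    refine ENNReal.rpow_le_rpow ?_ hqp.le
    rw [meanOn, mul_left_comm, ← lintegral_const_mul' _ _ (by finiteness)]
    refine mul_le_mul_right (lintegral_mono fun y => ?_) _
    rw [← ENNReal.mul_rpow_of_nonneg _ _ hp.le]
    exact ENNReal.rpow_le_rpow (ballSup_meanOsc_le_closedBallSup hf y) hp.le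
  calc _ ≤ ∫⁻ x, C₁ ^ (q / p) * 2 ^ (q / p) * (A x ^ q +
          (F.card : ℝ≥0∞) ^ (q / p) * ∑ v ∈ F, Φ (x + t • v) ^ (q / p)) := by
        refine lintegral_mono fun x => ?_
        refine (ENNReal.rpow_le_rpow (hloc f x t ht hf) hqp.le).trans ?_
        rw [ENNReal.mul_rpow_of_nonneg _ _ hqp.le, mul_assoc]
        refine mul_le_mul_right ((add_rpow_le_two_rpow_mul _ _ hqp.le).trans ?_) _
        rw [← ENNReal.rpow_mul, e]
        gcongr
        exact sum_rpow_le_card_rpow_mul _ _ hqp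
    _ = C₁ ^ (q / p) * 2 ^ (q / p) * ((∫⁻ x, A x ^ q) +
          (F.card : ℝ≥0∞) ^ (q / p) * (F.card * ∫⁻ x, Φ x ^ (q / p))) := by
        rw [lintegral_const_mul' _ _ (by finiteness), lintegral_add_left (hAm.pow_const q),
          lintegral_const_mul' _ _ (by finiteness), lintegral_finsetSum]
        · simp only [lintegral_add_right_eq_self (fun x => Φ x ^ (q / p)), Finset.sum_const,
            nsmul_eq_mul]
        · exact fun v _ => (hΦm.comp (measurable_add_const _)).pow_const _
    _ ≤ C₁ ^ (q / p) * 2 ^ (q / p) * (C₂ * (2 * 2 ^ n) ^ q * (∫⁻ x, Φ x ^ (q / p)) +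
          (F.card : ℝ≥0∞) ^ (q / p) * (F.card * ∫⁻ x, Φ x ^ (q / p))) := by
        gcongr
    _ = C₁ ^ (q / p) * 2 ^ (q / p) * (C₂ * (2 * 2 ^ n) ^ q + (F.card : ℝ≥0∞) ^ (q / p) * F.card) *
          ∫⁻ x, Φ x ^ (q / p) := by ring
    _ ≤ _ := by
        rw [mul_assoc _ (2 ^ q)]
        gcongr

theorem measurableEmbedding_ofLp (n : ℕ) :
    MeasurableEmbedding (WithLp.ofLp : EuclideanSpace ℝ (Fin n) → Fin n → ℝ) :=
  (MeasurableEquiv.toLp 2 (Fin n → ℝ)).symm.measurableEmbedding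

theorem cube_eq_preimage {n : ℕ} (x : EuclideanSpace ℝ (Fin n)) {r : ℝ} (hr : 0 < r) :
    cube x r = WithLp.ofLp ⁻¹' closedBall (WithLp.ofLp x) (r / 2) := by
  ext y
  rw [Set.mem_preimage, mem_closedBall, dist_pi_le_iff (by positivity)]
  rfl

theorem volume_cube {n : ℕ} (x : EuclideanSpace ℝ (Fin n)) {r : ℝ} (hr : 0 < r) :
    volume (cube x r) = volume (closedBall (WithLp.ofLp x) (r / 2)) := by
  rw [cube_eq_preimage x hr, (PiLp.volume_preserving_ofLp _).measure_preimage_emb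
    (measurableEmbedding_ofLp n)]

theorem inv_volume_mul_setLIntegral_cube {n : ℕ} (g : (Fin n → ℝ) → ℝ≥0∞)
    (x : EuclideanSpace ℝ (Fin n)) {r : ℝ} (hr : 0 < r) :
    (volume (cube x r))⁻¹ * ∫⁻ y in cube x r, g (WithLp.ofLp y) =
      meanOn g (closedBall (WithLp.ofLp x) (r / 2)) := by
  rw [volume_cube x hr, cube_eq_preimage x hr, meanOn,
    (PiLp.volume_preserving_ofLp _).setLIntegral_comp_preimage_emb (measurableEmbedding_ofLp n)]

theorem setAvg_cube {n : ℕ} (f : (Fin n → ℝ) → ℝ) (x : EuclideanSpace ℝ (Fin n)) {r : ℝ}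
    (hr : 0 < r) : setAvg (cube x r) (fun y => f (WithLp.ofLp y)) =
      (volume (closedBall (WithLp.ofLp x) (r / 2))).toReal⁻¹ *
        ∫ z in closedBall (WithLp.ofLp x) (r / 2), f z := by
  rw [setAvg, volume_cube x hr, cube_eq_preimage x hr,
    (PiLp.volume_preserving_ofLp _).setIntegral_preimage_emb (measurableEmbedding_ofLp n)]

theorem iSup_cube_eq_closedBallSup {n : ℕ} (F : Set (Fin n → ℝ) → ℝ≥0∞)
    (G : EuclideanSpace ℝ (Fin n) → ℝ → ℝ≥0∞)
    (h : ∀ z r, 0 < r → G z r = F (closedBall (WithLp.ofLp z) (r / 2)))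
    (x : EuclideanSpace ℝ (Fin n)) :
    ⨆ (z : EuclideanSpace ℝ (Fin n)) (r : ℝ) (_ : 0 < r) (_ : x ∈ cube z r), G z r =
      closedBallSup F (WithLp.ofLp x) := by
  rw [closedBallSup, ← (WithLp.equiv 2 (Fin n → ℝ)).iSup_comp]
  refine iSup_congr fun z => iSup_congr fun r => iSup_congr fun hr => ?_
  rw [h z r hr, cube_eq_preimage z hr]
  rfl

theorem fracMax_zero_eq {n : ℕ} (f : (Fin n → ℝ) → ℝ) (x : EuclideanSpace ℝ (Fin n)) :
    fracMax 0 (fun y => f (WithLp.ofLp y)) x =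
      closedBallSup (meanOn fun y => ‖f y‖ₑ) (WithLp.ofLp x) := by
  refine iSup_cube_eq_closedBallSup _ _ (fun z r hr => ?_) x
  rw [zero_div, zero_sub, ENNReal.rpow_neg_one, ← inv_volume_mul_setLIntegral_cube _ z hr]
  simp only [Real.enorm_eq_ofReal_abs]

theorem sharpMax_eq {n : ℕ} (f : (Fin n → ℝ) → ℝ) (x : EuclideanSpace ℝ (Fin n)) :
    sharpMax (fun y => f (WithLp.ofLp y)) x = closedBallSup (meanOsc f) (WithLp.ofLp x) := by
  refine iSup_cube_eq_closedBallSup _ _ (fun z r hr => ?_) x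
  rw [meanOsc, ← inv_volume_mul_setLIntegral_cube _ z hr, setAvg_cube f z hr]
  simp only [Real.enorm_eq_ofReal_abs]

theorem sliceNormE_eq {n : ℕ} (p q : ℝ) {t : ℝ} (ht : 0 < t) (g : (Fin n → ℝ) → ℝ≥0∞) :
    sliceNormE p q t (fun x : EuclideanSpace ℝ (Fin n) => g (WithLp.ofLp x)) =
      (∫⁻ x, meanOn (fun y => g y ^ p) (closedBall x (t / 2)) ^ (q / p)) ^ (1 / q) := by
  rw [sliceNormE, ← (PiLp.volume_preserving_ofLp (Fin n)).lintegral_comp_emb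
    (measurableEmbedding_ofLp n)]
  simp only [inv_volume_mul_setLIntegral_cube (fun y => g y ^ p) _ ht]

theorem integrableOn_closedBall_of_locallyIntegrable {n : ℕ} {f : (Fin n → ℝ) → ℝ}
    (hf : LocallyIntegrable (fun y : EuclideanSpace ℝ (Fin n) => f (WithLp.ofLp y)) volume)
    (z : Fin n → ℝ) (r : ℝ) : IntegrableOn f (closedBall z r) := by
  rw [← (PiLp.volume_preserving_ofLp (Fin n)).integrableOn_comp_preimage
    (measurableEmbedding_ofLp n)]
  exact hf.integrableOn_isCompact
    ((PiLp.homeomorph 2 fun _ : Fin n => ℝ).isCompact_preimage.2 (isCompact_closedBall z r))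

theorem statement6 (n : ℕ) (hn : 1 ≤ n) (p q : ℝ) (hp : 1 < p) (hq : 1 < q) :
    ∃ C > (0 : ℝ), ∀ t : ℝ, 0 < t → ∀ f : EuclideanSpace ℝ (Fin n) → ℝ, LocallyIntegrable f volume →
      sliceNormE p q t (fracMax 0 f) ≠ ∞ →
      sliceNormE p q t (fracMax 0 f) ≤ ENNReal.ofReal C * sliceNormE p q t (sharpMax f) := by
  have hq0 : 0 < q := by linarith
  obtain ⟨C, hC, h⟩ := exists_lintegral_meanOn_closedBallSup_le n hn (zero_lt_one.trans hp) hq0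
  refine ⟨(C ^ (1 / q)).toReal + 1, by positivity, fun t ht f hf => ?_⟩
  set f' : (Fin n → ℝ) → ℝ := fun y => f (WithLp.toLp 2 y)
  have hM : fracMax 0 f = fun x => closedBallSup (meanOn fun y => ‖f' y‖ₑ) (WithLp.ofLp x) :=
    funext (fracMax_zero_eq f')
  have hS : sharpMax f = fun x => closedBallSup (meanOsc f') (WithLp.ofLp x) :=
    funext (sharpMax_eq f')
  rw [hM, hS, sliceNormE_eq p q ht, sliceNormE_eq p q ht]
  intro hfin
  have key := h f' t ht (integrableOn_closedBall_of_locallyIntegrable hf) fun htop =>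
    hfin (by rw [htop, ENNReal.top_rpow_of_pos (by positivity)])
  refine (ENNReal.rpow_le_rpow key (by positivity)).trans ?_
  rw [ENNReal.mul_rpow_of_nonneg _ _ (by positivity)]
  gcongr
  refine ENNReal.le_ofReal_iff_toReal_le (by finiteness) (by positivity) |>.2 ?_
  linarith

end
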